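/- There exist rates λ, μ > 0 with λ < μ and integers 0 ≤ a < b such that ETT(b, a) < ETT(a, b), where ETT(a, b) = (a+2)/μ + (1/μ)·∫₀^∞ f_{a+1}(t)·EL_b(t) dt with f_{a+1}(t) = μ^{a+1} t^a e^{−μ t}/a! and EL_b given by the explicit integral formula; that is, a special customer required to pass through two independent M/M/1 queues with identical parameters can sometimes achieve a strictly smaller expected total time by joining the longer queue first. -/

import Mathlib

open Real MeasureTheory Set Filter

/-- γ(y) = 1 + ρ − 2√ρ·cos(y). -/
noncomputable def gam (ρ y : ℝ) : ℝ := 1 + ρ - 2 * Real.sqrt ρ * Real.cos y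

/-- a_k(y) = sin(k·y) − √ρ·sin((k+1)·y). -/
noncomputable def aco (ρ : ℝ) (k : ℕ) (y : ℝ) : ℝ :=
  Real.sin ((k : ℝ) * y) - Real.sqrt ρ * Real.sin (((k : ℝ) + 1) * y)

/-- Transient expected queue length of an M/M/1 queue started with `i` customers. -/
noncomputable def EL (lam mu : ℝ) (i : ℕ) (t : ℝ) : ℝ :=
  (2 / Real.pi) * (lam / mu) ^ ((1 - (i : ℝ)) / 2) *
    (∫ y in (0 : ℝ)..Real.pi,
      Real.exp (-(mu * t * gam (lam / mu) y)) / (gam (lam / mu) y) ^ 2 *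
        (aco (lam / mu) i y * Real.sin y)) +
  (lam / mu) / (1 - lam / mu)

/-- Transient probability that an M/M/1 queue started with `i` customers has `j` at time `t`. -/
noncomputable def pq (lam mu : ℝ) (i j : ℕ) (t : ℝ) : ℝ :=
  (2 / Real.pi) * (lam / mu) ^ (((j : ℝ) - (i : ℝ)) / 2) *
    (∫ y in (0 : ℝ)..Real.pi,
      Real.exp (-(mu * t * gam (lam / mu) y)) / gam (lam / mu) y *
        (aco (lam / mu) i y * aco (lam / mu) j y)) +
  (1 - lam / mu) * (lam / mu) ^ j

/-- Erlang(n) density with rate `mu`: f_n(t) = μⁿ t^{n−1} e^{−μt}/(n−1)!. -/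
noncomputable def erl (mu : ℝ) (n : ℕ) (t : ℝ) : ℝ :=
  mu ^ n * t ^ (n - 1) * Real.exp (-(mu * t)) / (Nat.factorial (n - 1) : ℝ)

/-- Expected total time to complete queue with `a` customers first, then queue with `b`. -/
noncomputable def ETT (lam mu : ℝ) (a b : ℕ) : ℝ :=
  ((a : ℝ) + 2) / mu + (1 / mu) * ∫ t in Set.Ioi (0 : ℝ), erl mu (a + 1) t * EL lam mu b t

/-- A bounded solution of `w (m+2) = κ w (m+1) - w m`, `w 0 = 0`, `κ ≥ 2`, vanishes. -/
theorem bdd_zero (κ C : ℝ) (hκ : 2 ≤ κ) (w : ℕ → ℝ) (h0 : w 0 = 0)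
    (hr : ∀ m, w (m + 2) = κ * w (m + 1) - w m) (hC : ∀ m, |w m| ≤ C) : ∀ m, w m = 0 := by
  have hd : ∀ m, |w 1| ≤ |w (m + 1)| - |w m| := by
    intro m
    induction m with
    | zero => simp [h0]
    | succ k ih =>
      have h1 : κ * |w (k + 1)| - |w k| ≤ |w (k + 2)| := by
        rw [hr k]
        have := abs_sub_abs_le_abs_sub (κ * w (k + 1)) (w k)
        rw [abs_mul, abs_of_nonneg (by linarith : (0 : ℝ) ≤ κ)] at this
        exact this
      have h2 : 2 * |w (k + 1)| ≤ κ * |w (k + 1)| :=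
        mul_le_mul_of_nonneg_right hκ (abs_nonneg _)
      show |w 1| ≤ |w (k + 2)| - |w (k + 1)|
      linarith
  have hl : ∀ m : ℕ, (m : ℝ) * |w 1| ≤ |w m| := by
    intro m
    induction m with
    | zero => simp
    | succ k ih =>
      have := hd k
      push_cast
      linarith
  have h1 : w 1 = 0 := by
    by_contra hne
    have hp : 0 < |w 1| := abs_pos.mpr hne
    obtain ⟨m, hm⟩ := exists_nat_gt (C / |w 1|)
    have h2 := hl m
    have h3 := hC m
    rw [div_lt_iff₀ hp] at hm
    linarith
  have : ∀ m, w m = 0 ∧ w (m + 1) = 0 := by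
    intro m
    induction m with
    | zero => exact ⟨h0, h1⟩
    | succ k ih => exact ⟨ih.2, by show w (k + 2) = 0; rw [hr, ih.1, ih.2]; ring⟩
  exact fun m => (this m).1

noncomputable def srho : ℝ := Real.sqrt (7 / 12)

noncomputable def gg (y : ℝ) : ℝ := gam (7 / 12) y

theorem srho_sq : srho ^ 2 = 7 / 12 := Real.sq_sqrt (by norm_num)

theorem srho_pos : 0 < srho := Real.sqrt_pos.mpr (by norm_num)

theorem srho_le : srho ≤ 4 / 5 := by
  have := srho_sq
  have := srho_pos
  nlinarith

theorem gg_eq (y : ℝ) : gg y = 1 + 7 / 12 - 2 * srho * Real.cos y := rfl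

theorem gg_lb (y : ℝ) : (1 / 25 : ℝ) ≤ gg y := by
  rw [gg_eq]
  have h1 := Real.cos_le_one y
  have := srho_sq
  have := srho_pos
  have := srho_le
  nlinarith

theorem gg_pos (y : ℝ) : 0 < gg y := lt_of_lt_of_le (by norm_num) (gg_lb y)

theorem gg_cont : Continuous gg := by
  unfold gg gam
  fun_prop

/-- kernel weight `1 / (γ (1+γ)^n)` -/
noncomputable def wt (n : ℕ) (y : ℝ) : ℝ := (gg y * (1 + gg y) ^ n)⁻¹

theorem wt_cont (n : ℕ) : Continuous (wt n) := by
  unfold wt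
  have := gg_cont
  refine Continuous.inv₀ (by fun_prop) (fun y => ?_)
  have := gg_pos y
  positivity

theorem wt_succ (n : ℕ) (y : ℝ) : (1 + gg y) * wt (n + 1) y = wt n y := by
  unfold wt
  have := gg_pos y
  field_simp
  ring

noncomputable def SS (n m : ℕ) : ℝ :=
  (2 / π) * ∫ y in (0 : ℝ)..π, wt n y * (Real.sin (m * y) * Real.sin y)

theorem SS_int (n m : ℕ) : IntervalIntegrable
    (fun y => wt n y * (Real.sin (m * y) * Real.sin y)) volume 0 π := by
  have := wt_cont n
  exact Continuous.intervalIntegrable (by fun_prop) _ _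

theorem SS_bdd (n : ℕ) : ∃ C, ∀ m, |SS n m| ≤ C := by
  refine ⟨(2 / π) * ∫ y in (0 : ℝ)..π, |wt n y|, fun m => ?_⟩
  have hw := wt_cont n
  unfold SS
  rw [abs_mul, abs_of_pos (by positivity : (0 : ℝ) < 2 / π)]
  refine mul_le_mul_of_nonneg_left ?_ (by positivity)
  refine (intervalIntegral.abs_integral_le_integral_abs Real.pi_pos.le).trans ?_
  refine intervalIntegral.integral_mono_on Real.pi_pos.le
    (Continuous.intervalIntegrable (by fun_prop) _ _)
    (Continuous.intervalIntegrable (by fun_prop) _ _) (fun y _ => ?_)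
  rw [abs_mul, abs_mul]
  have h1 := Real.abs_sin_le_one (m * y)
  have h2 := Real.abs_sin_le_one y
  have h3 : |Real.sin (m * y)| * |Real.sin y| ≤ 1 := by
    have := abs_nonneg (Real.sin (m * y))
    have := abs_nonneg (Real.sin y)
    nlinarith
  have := mul_le_mul_of_nonneg_left h3 (abs_nonneg (wt n y))
  linarith

theorem SS_zero (n : ℕ) : SS n 0 = 0 := by simp [SS]

theorem trig_rec (m : ℕ) (y : ℝ) :
    gg y * Real.sin (((m + 1 : ℕ) : ℝ) * y) = (1 + 7 / 12) * Real.sin (((m + 1 : ℕ) : ℝ) * y)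
      - srho * Real.sin (((m + 2 : ℕ) : ℝ) * y) - srho * Real.sin ((m : ℝ) * y) := by
  have e1 : ((m + 2 : ℕ) : ℝ) * y = ((m + 1 : ℕ) : ℝ) * y + y := by push_cast; ring
  have e2 : (m : ℝ) * y = ((m + 1 : ℕ) : ℝ) * y - y := by push_cast; ring
  rw [e1, e2, Real.sin_add, Real.sin_sub, gg_eq]
  ring

theorem SS_rec (n m : ℕ) : SS n (m + 1) =
    (2 + 7 / 12) * SS (n + 1) (m + 1) - srho * SS (n + 1) (m + 2) - srho * SS (n + 1) m := by
  have h : ∫ y in (0 : ℝ)..π, wt n y * (Real.sin (((m + 1 : ℕ) : ℝ) * y) * Real.sin y) =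
      ∫ y in (0 : ℝ)..π, ((2 + 7 / 12) *
        (wt (n + 1) y * (Real.sin (((m + 1 : ℕ) : ℝ) * y) * Real.sin y))
        - srho * (wt (n + 1) y * (Real.sin (((m + 2 : ℕ) : ℝ) * y) * Real.sin y))
        - srho * (wt (n + 1) y * (Real.sin ((m : ℝ) * y) * Real.sin y))) := by
    congr 1
    ext y
    rw [← wt_succ n y]
    have := trig_rec m y
    linear_combination (wt (n + 1) y * Real.sin y) * this
  have i1 := (SS_int (n + 1) (m + 1)).const_mul (2 + 7 / 12)
  have i2 := (SS_int (n + 1) (m + 2)).const_mul srho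
  have i3 := (SS_int (n + 1) m).const_mul srho
  unfold SS
  rw [h, intervalIntegral.integral_sub (i1.sub i2) i3, intervalIntegral.integral_sub i1 i2,
    intervalIntegral.integral_const_mul, intervalIntegral.integral_const_mul,
    intervalIntegral.integral_const_mul]
  ring

theorem int_cos (k : ℕ) (hk : k ≠ 0) : ∫ y in (0 : ℝ)..π, Real.cos (k * y) = 0 := by
  have hk' : (k : ℝ) ≠ 0 := by exact_mod_cast hk
  rw [intervalIntegral.integral_comp_mul_left (fun y => Real.cos y) hk', integral_cos]
  simp [Real.sin_nat_mul_pi]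

theorem orth (m : ℕ) : (2 / π) * ∫ y in (0 : ℝ)..π,
    Real.sin (((m + 1 : ℕ) : ℝ) * y) * Real.sin y = if m = 0 then 1 else 0 := by
  have h : ∫ y in (0 : ℝ)..π, Real.sin (((m + 1 : ℕ) : ℝ) * y) * Real.sin y =
      ∫ y in (0 : ℝ)..π, ((1 / 2) * Real.cos ((m : ℝ) * y)
        - (1 / 2) * Real.cos (((m + 2 : ℕ) : ℝ) * y)) := by
    congr 1
    ext y
    have e1 : ((m + 2 : ℕ) : ℝ) * y = ((m + 1 : ℕ) : ℝ) * y + y := by push_cast; ring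
    have e2 : (m : ℝ) * y = ((m + 1 : ℕ) : ℝ) * y - y := by push_cast; ring
    rw [e1, e2, Real.cos_add, Real.cos_sub]
    ring
  rw [h, intervalIntegral.integral_sub
    (Continuous.intervalIntegrable (by fun_prop) _ _)
    (Continuous.intervalIntegrable (by fun_prop) _ _),
    intervalIntegral.integral_const_mul, intervalIntegral.integral_const_mul,
    int_cos (m + 2) (by omega)]
  split_ifs with hm
  · subst hm
    have := Real.pi_ne_zero
    simp
    field_simp
  · rw [int_cos m hm]
    simp

theorem SS_rec0 (m : ℕ) : (if m = 0 then (1 : ℝ) else 0) =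
    (1 + 7 / 12) * SS 0 (m + 1) - srho * SS 0 (m + 2) - srho * SS 0 m := by
  have h : ∫ y in (0 : ℝ)..π, Real.sin (((m + 1 : ℕ) : ℝ) * y) * Real.sin y =
      ∫ y in (0 : ℝ)..π, ((1 + 7 / 12) *
        (wt 0 y * (Real.sin (((m + 1 : ℕ) : ℝ) * y) * Real.sin y))
        - srho * (wt 0 y * (Real.sin (((m + 2 : ℕ) : ℝ) * y) * Real.sin y))
        - srho * (wt 0 y * (Real.sin ((m : ℝ) * y) * Real.sin y))) := by
    congr 1
    ext y
    have := trig_rec m y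
    have h2 : wt 0 y * gg y = 1 := by
      unfold wt
      have := gg_pos y
      field_simp
    linear_combination (wt 0 y * Real.sin y) * this -
      (Real.sin (((m + 1 : ℕ) : ℝ) * y) * Real.sin y) * h2
  have i1 := (SS_int 0 (m + 1)).const_mul (1 + 7 / 12)
  have i2 := (SS_int 0 (m + 2)).const_mul srho
  have i3 := (SS_int 0 m).const_mul srho
  rw [← orth]
  unfold SS
  rw [h, intervalIntegral.integral_sub (i1.sub i2) i3, intervalIntegral.integral_sub i1 i2,
    intervalIntegral.integral_const_mul, intervalIntegral.integral_const_mul,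
    intervalIntegral.integral_const_mul]
  ring

def PP (n : ℕ) (q : ℕ → ℝ) : Prop :=
  ∀ m : ℕ, srho * SS n (m + 1) = srho ^ (m + 1) * (1 - (3 / 7) ^ (m + 1) * q (m + 1))

theorem PP_zero : PP 0 (fun _ => 0) := by
  have hs := srho_pos
  have hs2 := srho_sq
  obtain ⟨C, hC⟩ := SS_bdd 0
  have key := bdd_zero ((1 + 7 / 12) / srho) (C + 2)
    (by rw [le_div_iff₀ hs]; nlinarith [srho_le])
    (fun m => if m = 0 then 0 else SS 0 m - srho ^ (m - 1)) (by simp) ?_ ?_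
  · intro m
    have := key (m + 1)
    simp at this
    have h : SS 0 (m + 1) = srho ^ m := by linarith
    rw [h]
    ring
  · intro m
    have h := SS_rec0 m
    rcases m with _ | m
    · simp [SS_zero] at h ⊢
      field_simp
      linear_combination (12 : ℝ) * h + (-12 : ℝ) * hs2
    · simp at h ⊢
      field_simp
      have e : srho ^ (m + 1 + 1) = srho ^ m * (7 / 12) := by rw [← hs2]; ring
      rw [e, pow_succ]
      linear_combination (12 : ℝ) * h
  · intro m
    have h1 : |srho ^ (m - 1)| ≤ 1 := by
      rw [abs_of_nonneg (by positivity)]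
      exact pow_le_one₀ hs.le (by linarith [srho_le])
    have h2 := hC m
    have h3 := abs_nonneg (SS 0 m)
    split_ifs
    · simp; linarith
    · refine (abs_sub _ _).trans ?_
      linarith

def BB (q : ℕ → ℝ) : Prop := ∃ C : ℝ, ∀ m : ℕ, |q m| ≤ C * Real.exp m

theorem BB_add (p q : ℕ → ℝ) (hp : BB p) (hq : BB q) : BB (fun m => p m + q m) := by
  obtain ⟨C, hC⟩ := hp
  obtain ⟨D, hD⟩ := hq
  refine ⟨C + D, fun m => (abs_add_le _ _).trans ?_⟩
  have := hC m
  have := hD m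
  linarith

theorem BB_mono (c : ℝ) (k : ℕ) : BB (fun m => c * (m : ℝ) ^ k) := by
  refine ⟨|c| * (Nat.factorial k : ℝ), fun m => ?_⟩
  have h := Real.pow_div_factorial_le_exp (x := (m : ℝ)) (by positivity) k
  rw [div_le_iff₀ (by positivity)] at h
  rw [abs_mul, abs_of_nonneg (by positivity : (0 : ℝ) ≤ (m : ℝ) ^ k), mul_assoc]
  refine mul_le_mul_of_nonneg_left ?_ (abs_nonneg _)
  linarith

theorem PP_step (n : ℕ) (q q' : ℕ → ℝ) (hP : PP n q) (hB : BB q') (h0 : q' 0 = 1)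
    (hr : ∀ m : ℕ, (2 + 7 / 12) * q' (m + 1) - (1 / 4) * q' (m + 2) - (7 / 3) * q' m = q (m + 1)) :
    PP (n + 1) q' := by
  have hs := srho_pos
  have hs2 := srho_sq
  obtain ⟨C, hC⟩ := SS_bdd (n + 1)
  obtain ⟨D, hD⟩ := hB
  have key := bdd_zero ((2 + 7 / 12) / srho) (C + 1 + D)
    (by rw [le_div_iff₀ hs]; nlinarith [srho_le])
    (fun m => srho * SS (n + 1) m - srho ^ m * (1 - (3 / 7) ^ m * q' m))
    (by simp [SS_zero, h0]) ?_ ?_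
  · intro m
    have := key (m + 1)
    linarith
  · intro m
    have h1 := SS_rec n m
    have h2 := hP m
    have h3 := hr m
    field_simp
    have e : srho ^ (m + 2) = srho ^ m * (7 / 12) := by rw [← hs2]; ring
    have e' : srho ^ (m + 1) = srho ^ m * srho := pow_succ _ _
    rw [e'] at h2
    rw [← h3, h1] at h2
    rw [e, e', pow_add (3 / 7 : ℝ) m 2, pow_add (3 / 7 : ℝ) m 1]
    rw [pow_add (3 / 7 : ℝ) m 1] at h2
    linear_combination (-12 : ℝ) * h2
  · intro m
    have h1 : |srho ^ m| ≤ 1 := by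
      rw [abs_of_nonneg (by positivity)]
      exact pow_le_one₀ hs.le (by linarith [srho_le])
    have h2 := hC m
    have h4 : |srho * SS (n + 1) m| ≤ C := by
      rw [abs_mul, abs_of_pos hs]
      have := srho_le
      have := abs_nonneg (SS (n + 1) m)
      nlinarith
    have h5 : |srho ^ m * ((3 / 7) ^ m * q' m)| ≤ D := by
      have hD0 : 0 ≤ D := by
        have := hD 0
        have h6 := abs_nonneg (q' 0)
        simp at this
        linarith
      rw [abs_mul, abs_mul, abs_of_nonneg (by positivity : (0 : ℝ) ≤ srho ^ m),
        abs_of_nonneg (by positivity : (0 : ℝ) ≤ (3 / 7) ^ m)]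
      calc srho ^ m * ((3 / 7) ^ m * |q' m|) ≤ srho ^ m * ((3 / 7) ^ m * (D * Real.exp m)) := by
            have := hD m
            gcongr
        _ = D * (srho * (3 / 7) * Real.exp 1) ^ m := by
            rw [mul_pow, mul_pow, ← Real.exp_nat_mul, mul_one]; ring
        _ ≤ D * 1 := by
            refine mul_le_mul_of_nonneg_left (pow_le_one₀ (by positivity) ?_) hD0
            have := Real.exp_one_lt_d9
            have := srho_le
            have := Real.exp_pos 1
            nlinarith
        _ = D := mul_one D
    have e : srho * SS (n + 1) m - srho ^ m * (1 - (3 / 7) ^ m * q' m) =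
      srho * SS (n + 1) m - srho ^ m + srho ^ m * ((3 / 7) ^ m * q' m) := by ring
    rw [e]
    refine (abs_add_le _ _).trans ?_
    have := abs_sub (srho * SS (n + 1) m) (srho ^ m)
    linarith

noncomputable def q1 (m : ℕ) : ℝ := (1) * (m:ℝ)^0
noncomputable def q2 (m : ℕ) : ℝ := (1) * (m:ℝ)^0 + (12/25) * (m:ℝ)^1
noncomputable def q3 (m : ℕ) : ℝ := (1) * (m:ℝ)^0 + (9732/15625) * (m:ℝ)^1 + (72/625) * (m:ℝ)^2
noncomputable def q4 (m : ℕ) : ℝ := (1) * (m:ℝ)^0 + (6732804/9765625) * (m:ℝ)^1 + (71784/390625) * (m:ℝ)^2 + (288/15625) * (m:ℝ)^3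
noncomputable def q5 (m : ℕ) : ℝ := (1) * (m:ℝ)^0 + (888686772/1220703125) * (m:ℝ)^1 + (11031912/48828125) * (m:ℝ)^2 + (340704/9765625) * (m:ℝ)^3 + (864/390625) * (m:ℝ)^4
noncomputable def q6 (m : ℕ) : ℝ := (1) * (m:ℝ)^0 + (2873421502788/3814697265625) * (m:ℝ)^1 + (38751379848/152587890625) * (m:ℝ)^2 + (289652832/6103515625) * (m:ℝ)^3 + (1182816/244140625) * (m:ℝ)^4 + (10368/48828125) * (m:ℝ)^5
noncomputable def q7 (m : ℕ) : ℝ := (1) * (m:ℝ)^0 + (1838309373843204/2384185791015625) * (m:ℝ)^1 + (26111846930184/95367431640625) * (m:ℝ)^2 + (217255058784/3814697265625) * (m:ℝ)^3 + (1105893216/152587890625) * (m:ℝ)^4 + (3224448/6103515625) * (m:ℝ)^5 + (20736/1220703125) * (m:ℝ)^6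
noncomputable def q8 (m : ℕ) : ℝ := (1) * (m:ℝ)^0 + (8180086722342098268/10430812835693359375) * (m:ℝ)^1 + (17196944061229704/59604644775390625) * (m:ℝ)^2 + (30635850315744/476837158203125) * (m:ℝ)^3 + (885732808032/95367431640625) * (m:ℝ)^4 + (3294525312/3814697265625) * (m:ℝ)^5 + (36101376/762939453125) * (m:ℝ)^6 + (248832/213623046875) * (m:ℝ)^7


theorem Pq1 : PP 1 q1 := by
  refine PP_step 0 (fun _ => 0) q1 PP_zero ?_ ?_ ?_
  · unfold q1
    repeat' apply BB_add
    all_goals exact BB_mono _ _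
  · simp [q1]
  · intro m
    simp only [q1]
    push_cast
    ring

theorem Pq2 : PP 2 q2 := by
  refine PP_step 1 q1 q2 Pq1 ?_ ?_ ?_
  · unfold q2
    repeat' apply BB_add
    all_goals exact BB_mono _ _
  · simp [q2]
  · intro m
    simp only [q2, q1]
    push_cast
    ring

theorem Pq3 : PP 3 q3 := by
  refine PP_step 2 q2 q3 Pq2 ?_ ?_ ?_
  · unfold q3
    repeat' apply BB_add
    all_goals exact BB_mono _ _
  · simp [q3]
  · intro m
    simp only [q3, q2]
    push_cast
    ring

theorem Pq4 : PP 4 q4 := by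
  refine PP_step 3 q3 q4 Pq3 ?_ ?_ ?_
  · unfold q4
    repeat' apply BB_add
    all_goals exact BB_mono _ _
  · simp [q4]
  · intro m
    simp only [q4, q3]
    push_cast
    ring

theorem Pq5 : PP 5 q5 := by
  refine PP_step 4 q4 q5 Pq4 ?_ ?_ ?_
  · unfold q5
    repeat' apply BB_add
    all_goals exact BB_mono _ _
  · simp [q5]
  · intro m
    simp only [q5, q4]
    push_cast
    ring

theorem Pq6 : PP 6 q6 := by
  refine PP_step 5 q5 q6 Pq5 ?_ ?_ ?_
  · unfold q6
    repeat' apply BB_add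
    all_goals exact BB_mono _ _
  · simp [q6]
  · intro m
    simp only [q6, q5]
    push_cast
    ring

theorem Pq7 : PP 7 q7 := by
  refine PP_step 6 q6 q7 Pq6 ?_ ?_ ?_
  · unfold q7
    repeat' apply BB_add
    all_goals exact BB_mono _ _
  · simp [q7]
  · intro m
    simp only [q7, q6]
    push_cast
    ring

theorem Pq8 : PP 8 q8 := by
  refine PP_step 7 q7 q8 Pq7 ?_ ?_ ?_
  · unfold q8
    repeat' apply BB_add
    all_goals exact BB_mono _ _
  · simp [q8]
  · intro m
    simp only [q8, q7]
    push_cast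
    ring


noncomputable def HH (n b : ℕ) : ℝ :=
  (2 / π) * ∫ y in (0 : ℝ)..π,
    (gg y ^ 2 * (1 + gg y) ^ n)⁻¹ * (aco (7 / 12) b y * Real.sin y)

theorem aco_cont (b : ℕ) : Continuous (aco (7 / 12) b) := by
  unfold aco
  fun_prop

theorem wt2_cont (n : ℕ) : Continuous (fun y => (gg y ^ 2 * (1 + gg y) ^ n)⁻¹) := by
  have := gg_cont
  refine Continuous.inv₀ (by fun_prop) (fun y => ?_)
  have := gg_pos y
  positivity

theorem HH_int (n b : ℕ) : IntervalIntegrable (fun y =>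
    (gg y ^ 2 * (1 + gg y) ^ n)⁻¹ * (aco (7 / 12) b y * Real.sin y)) volume 0 π := by
  have := wt2_cont n
  have := aco_cont b
  exact Continuous.intervalIntegrable (by fun_prop) _ _

theorem aco_eq (b : ℕ) (y : ℝ) : aco (7 / 12) b y =
    Real.sin ((b : ℝ) * y) - srho * Real.sin (((b + 1 : ℕ) : ℝ) * y) := by
  simp [aco, srho]

theorem HH_b (n b : ℕ) : HH n (b + 1) = srho * HH n b + SS n (b + 1) := by
  have i1 := (HH_int n b).const_mul srho
  have i2 := SS_int n (b + 1)
  have h : ∫ y in (0 : ℝ)..π,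
      (gg y ^ 2 * (1 + gg y) ^ n)⁻¹ * (aco (7 / 12) (b + 1) y * Real.sin y) =
      ∫ y in (0 : ℝ)..π, (srho * ((gg y ^ 2 * (1 + gg y) ^ n)⁻¹ * (aco (7 / 12) b y * Real.sin y)) +
        wt n y * (Real.sin (((b + 1 : ℕ) : ℝ) * y) * Real.sin y)) := by
    congr 1
    ext y
    have hg := gg_pos y
    have h1 : wt n y = gg y * (gg y ^ 2 * (1 + gg y) ^ n)⁻¹ := by
      unfold wt
      field_simp
    rw [h1, aco_eq, aco_eq]
    have h2 := trig_rec b y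
    have hs2 := srho_sq
    linear_combination (-(gg y ^ 2 * (1 + gg y) ^ n)⁻¹ * Real.sin y) * h2 +
      (gg y ^ 2 * (1 + gg y) ^ n)⁻¹ * Real.sin y * Real.sin (((b + 1 : ℕ) : ℝ) * y) * hs2
  unfold HH SS
  rw [h, intervalIntegral.integral_add i1 i2, intervalIntegral.integral_const_mul]
  ring

theorem HH_n (n b : ℕ) : HH n b = HH (n + 1) b + SS (n + 1) b - srho * SS (n + 1) (b + 1) := by
  have i1 := HH_int (n + 1) b
  have i2 := SS_int (n + 1) b
  have i3 := (SS_int (n + 1) (b + 1)).const_mul srho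
  have h : ∫ y in (0 : ℝ)..π,
      (gg y ^ 2 * (1 + gg y) ^ n)⁻¹ * (aco (7 / 12) b y * Real.sin y) =
      ∫ y in (0 : ℝ)..π,
        ((gg y ^ 2 * (1 + gg y) ^ (n + 1))⁻¹ * (aco (7 / 12) b y * Real.sin y) +
        wt (n + 1) y * (Real.sin ((b : ℝ) * y) * Real.sin y) -
        srho * (wt (n + 1) y * (Real.sin (((b + 1 : ℕ) : ℝ) * y) * Real.sin y))) := by
    congr 1
    ext y
    have hg := gg_pos y
    have h1 : wt (n + 1) y = gg y * (gg y ^ 2 * (1 + gg y) ^ (n + 1))⁻¹ := by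
      unfold wt
      field_simp
    have h2 : (gg y ^ 2 * (1 + gg y) ^ n)⁻¹ =
        (1 + gg y) * (gg y ^ 2 * (1 + gg y) ^ (n + 1))⁻¹ := by
      field_simp
      ring
    rw [h1, h2, aco_eq]
    ring
  unfold HH SS
  rw [h, intervalIntegral.integral_sub (i1.add i2) i3, intervalIntegral.integral_add i1 i2,
    intervalIntegral.integral_const_mul]
  ring

theorem lap (a : ℕ) (r : ℝ) (hr : 0 < r) :
    ∫ t in Ioi (0 : ℝ), t ^ a * Real.exp (-(r * t)) = (Nat.factorial a : ℝ) / r ^ (a + 1) := by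
  have h := Real.integral_rpow_mul_exp_neg_mul_Ioi (a := (a : ℝ) + 1) (r := r) (by positivity) hr
  rw [Real.Gamma_nat_eq_factorial] at h
  have e : (a : ℝ) + 1 = ((a + 1 : ℕ) : ℝ) := by push_cast; ring
  rw [add_sub_cancel_right, e, Real.rpow_natCast] at h
  simp only [Real.rpow_natCast] at h
  rw [h, one_div, inv_pow]
  ring

theorem lap_int (a : ℕ) :
    IntegrableOn (fun t : ℝ => t ^ a * Real.exp (-t)) (Ioi 0) := by
  have h := Real.GammaIntegral_convergent (s := (a : ℝ) + 1) (by positivity)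
  refine h.congr_fun (fun t _ => ?_) measurableSet_Ioi
  simp [mul_comm]

theorem erl_int (n : ℕ) : IntegrableOn (erl 1 (n + 1)) (Ioi 0) := by
  have h : IntegrableOn (fun t : ℝ => (Nat.factorial n : ℝ)⁻¹ * (t ^ n * Real.exp (-t))) (Ioi 0) :=
    (lap_int n).const_mul _
  refine h.congr_fun (fun t _ => ?_) measurableSet_Ioi
  simp [erl]
  ring

theorem erl_lap (n : ℕ) (g : ℝ) (hg : 0 ≤ g) :
    ∫ t in Ioi (0 : ℝ), erl 1 (n + 1) t * Real.exp (-(t * g)) = ((1 + g) ^ (n + 1))⁻¹ := by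
  have h := lap n (1 + g) (by linarith)
  have e : ∀ t : ℝ, erl 1 (n + 1) t * Real.exp (-(t * g)) =
      (Nat.factorial n : ℝ)⁻¹ * (t ^ n * Real.exp (-((1 + g) * t))) := by
    intro t
    have : -((1 + g) * t) = -(1 * t) + -(t * g) := by ring
    rw [this, Real.exp_add]
    simp [erl]
    ring
  simp only [e]
  rw [integral_const_mul, h]
  have : (Nat.factorial n : ℝ) ≠ 0 := by positivity
  field_simp

theorem erl_one (n : ℕ) : ∫ t in Ioi (0 : ℝ), erl 1 (n + 1) t = 1 := by
  have := erl_lap n 0 le_rfl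
  simpa using this

theorem erl_cont (n : ℕ) : Continuous (erl 1 (n + 1)) := by
  unfold erl
  fun_prop

/-- the y-part of the integrand -/
noncomputable def ff (b : ℕ) (y : ℝ) : ℝ := (gg y ^ 2)⁻¹ * (aco (7 / 12) b y * Real.sin y)

theorem ff_cont (b : ℕ) : Continuous (ff b) := by
  have h1 := wt2_cont 0
  simp only [pow_zero, mul_one] at h1
  have h2 := aco_cont b
  unfold ff
  fun_prop

theorem prod_int (n b : ℕ) : Integrable
    (Function.uncurry (fun t y : ℝ => erl 1 (n + 1) t * Real.exp (-(t * gg y)) * ff b y))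
    ((volume.restrict (Ioi 0)).prod (volume.restrict (Ioc 0 π))) := by
  have h1 : Integrable (erl 1 (n + 1)) (volume.restrict (Ioi 0)) := erl_int n
  have h2 : Integrable (ff b) (volume.restrict (Ioc 0 π)) :=
    ((ff_cont b).integrableOn_Icc).mono_set Ioc_subset_Icc_self
  have h3 := h1.mul_prod h2
  refine h3.mono ?_ ?_
  · have c1 := erl_cont n
    have c2 := ff_cont b
    have c3 := gg_cont
    refine Continuous.aestronglyMeasurable ?_
    unfold Function.uncurry
    fun_prop
  · rw [Measure.prod_restrict]
    refine (ae_restrict_iff' (measurableSet_Ioi.prod measurableSet_Ioc)).mpr (ae_of_all _ ?_)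
    rintro ⟨t, y⟩ ⟨ht, _⟩
    simp only [Function.uncurry, norm_mul, Real.norm_eq_abs, Real.abs_exp]
    have ht' : 0 < t := ht
    have hg := gg_pos y
    have : Real.exp (-(t * gg y)) ≤ 1 := Real.exp_le_one_iff.mpr (by nlinarith)
    have h4 : |erl 1 (n + 1) t| * Real.exp (-(t * gg y)) ≤ |erl 1 (n + 1) t| * 1 :=
      mul_le_mul_of_nonneg_left this (abs_nonneg _)
    have := mul_le_mul_of_nonneg_right h4 (abs_nonneg (ff b y))
    linarith

theorem swap (n b : ℕ) :
    Integrable (fun t => erl 1 (n + 1) t * ∫ y in (0 : ℝ)..π, Real.exp (-(t * gg y)) * ff b y)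
      (volume.restrict (Ioi 0)) ∧
    (2 / π) * ∫ t in Ioi (0 : ℝ), erl 1 (n + 1) t *
      ∫ y in (0 : ℝ)..π, Real.exp (-(t * gg y)) * ff b y = HH (n + 1) b := by
  have hp := prod_int n b
  have e : ∀ t : ℝ, erl 1 (n + 1) t * ∫ y in (0 : ℝ)..π, Real.exp (-(t * gg y)) * ff b y =
      ∫ y in Ioc 0 π, erl 1 (n + 1) t * Real.exp (-(t * gg y)) * ff b y := by
    intro t
    rw [intervalIntegral.integral_of_le Real.pi_pos.le, ← integral_const_mul]
    congr 1
    ext y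
    ring
  simp only [e]
  refine ⟨hp.integral_prod_left, ?_⟩
  rw [integral_integral_swap hp]
  unfold HH
  rw [intervalIntegral.integral_of_le Real.pi_pos.le]
  congr 2
  ext y
  rw [integral_mul_const, erl_lap n (gg y) (gg_pos y).le]
  unfold ff
  rw [mul_inv]
  ring

theorem EL_eq (b : ℕ) (t : ℝ) : EL (7 / 12) 1 b t =
    (2 / π) * (7 / 12 : ℝ) ^ ((1 - (b : ℝ)) / 2) *
      (∫ y in (0 : ℝ)..π, Real.exp (-(t * gg y)) * ff b y) + 7 / 5 := by
  unfold EL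
  simp only [div_one, one_mul]
  congr 1
  · congr 2
    ext y
    unfold ff
    show Real.exp (-(t * gg y)) / gg y ^ 2 * _ = _
    ring
  · norm_num

theorem ETT_eq (a b : ℕ) : ETT (7 / 12) 1 a b =
    (a : ℝ) + 2 + (7 / 12 : ℝ) ^ ((1 - (b : ℝ)) / 2) * HH (a + 1) b + 7 / 5 := by
  obtain ⟨h1, h2⟩ := swap a b
  have e : ∀ t : ℝ, erl 1 (a + 1) t * EL (7 / 12) 1 b t =
      (2 / π) * (7 / 12 : ℝ) ^ ((1 - (b : ℝ)) / 2) *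
      (erl 1 (a + 1) t * ∫ y in (0 : ℝ)..π, Real.exp (-(t * gg y)) * ff b y)
        + erl 1 (a + 1) t * (7 / 5) := by
    intro t
    rw [EL_eq]
    ring
  have i2 : Integrable (fun t => erl 1 (a + 1) t * (7 / 5)) (volume.restrict (Ioi 0)) :=
    (erl_int a).mul_const _
  unfold ETT
  simp only [e]
  rw [integral_add (h1.const_mul _) i2, integral_const_mul, integral_mul_const, erl_one, ← h2]
  ring

theorem SS_val (n m : ℕ) (q : ℕ → ℝ) (h : PP n q) :
    SS n (m + 1) = srho ^ m * (1 - (3 / 7) ^ (m + 1) * q (m + 1)) := by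
  have h1 := h m
  have h2 := srho_pos
  rw [pow_succ] at h1
  have : srho * (SS n (m + 1)) = srho * (srho ^ m * (1 - (3 / 7) ^ (m + 1) * q (m + 1))) := by
    rw [h1]; ring
  exact mul_left_cancel₀ h2.ne' this

/-- There exist rates λ < μ and initial lengths a < b for which joining the longer
queue first yields a strictly smaller expected total time. -/
theorem exists_longer_first_better :
    ∃ lam mu : ℝ, 0 < lam ∧ lam < mu ∧
      ∃ a b : ℕ, a < b ∧ ETT lam mu b a < ETT lam mu a b := by
  refine ⟨7 / 12, 1, by norm_num, by norm_num, 5, 7, by norm_num, ?_⟩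
  rw [ETT_eq, ETT_eq]
  have r1 : (7 / 12 : ℝ) ^ ((1 - ((7 : ℕ) : ℝ)) / 2) = (12 / 7) ^ 3 := by
    rw [show (1 - ((7 : ℕ) : ℝ)) / 2 = -((3 : ℕ) : ℝ) by norm_num,
      Real.rpow_neg (by norm_num), Real.rpow_natCast]
    norm_num
  have r2 : (7 / 12 : ℝ) ^ ((1 - ((5 : ℕ) : ℝ)) / 2) = (12 / 7) ^ 2 := by
    rw [show (1 - ((5 : ℕ) : ℝ)) / 2 = -((2 : ℕ) : ℝ) by norm_num,
      Real.rpow_neg (by norm_num), Real.rpow_natCast]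
    norm_num
  rw [r1, r2]
  have hs2 := srho_sq
  have hs4 : srho ^ 4 = (7 / 12) ^ 2 := by rw [← hs2]; ring
  have hs5 : srho ^ 5 = (7 / 12) ^ 2 * srho := by rw [← hs2]; ring
  have hs6 : srho ^ 6 = (7 / 12) ^ 3 := by rw [← hs2]; ring
  have v66 := SS_val 6 5 q6 Pq6
  have v67 := SS_val 6 6 q6 Pq6
  have v75 := SS_val 7 4 q7 Pq7
  have v76 := SS_val 7 5 q7 Pq7
  have v85 := SS_val 8 4 q8 Pq8
  have v86 := SS_val 8 5 q8 Pq8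
  rw [hs4] at v75 v85
  rw [hs5] at v66 v76 v86
  rw [hs6] at v67
  norm_num [q6, q7, q8] at v66 v67 v75 v76 v85 v86
  have k1 := HH_b 6 6
  have k2 := HH_b 6 5
  have k3 := HH_n 6 5
  have k4 := HH_n 7 5
  norm_num at k1 k2 k3 k4
  have m1 : HH 6 7 = 7 / 12 * HH 6 5 + srho * SS 6 6 + SS 6 7 := by
    rw [k1, k2]; linear_combination HH 6 5 * hs2
  have m66 : srho * SS 6 6 = srho ^ 2 * (SS 6 6 / srho) := by
    have := srho_pos; field_simp
  norm_num
  rw [m1, k3, k4, v66, v67, v75, v76, v85, v86]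
  ring_nf
  rw [hs2]
  ring_nf
  linarith
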